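/- There exists a constant C > 0 such that for every finite prefix code X whose literal automaton A_X has n ≥ 2 states and is synchronizing, the reset threshold of A_X is at most C·n·(log₂ n)³. -/

import Mathlib

open scoped Classical

section Defs

variable {Q A : Type*}

/-- Action of a word in a partial DFA with transition function `δ`
(`none` means the undefined value ⊥). -/
def stepWord (δ : Q → A → Option Q) : Q → List A → Option Q
  | q, [] => some q
  | q, a :: w => (δ q a).bind (fun p => stepWord δ p w)

/-- The image `δ(S, w)` of a set of states under the action of a word. -/
def img (δ : Q → A → Option Q) (S : Set Q) (w : List A) : Set Q :=
  {p | ∃ q ∈ S, stepWord δ q w = some p}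

/-- The inseparability equivalence `p ≡ q`. -/
def Insep (δ : Q → A → Option Q) (p q : Q) : Prop :=
  ∀ u : List A, (stepWord δ p u).isSome ↔ (stepWord δ q u).isSome

/-- `κ(S)`: the number of inseparability classes intersecting `S`. -/
noncomputable def kappa (δ : Q → A → Option Q) (S : Set Q) : ℕ :=
  {C : Set Q | ∃ p ∈ S, C = {q | Insep δ p q}}.ncard

def StronglyConnected (δ : Q → A → Option Q) : Prop :=
  ∀ p q : Q, ∃ w : List A, stepWord δ p w = some q

/-- The transition function of the fixing automaton `A^F`. -/
def fixDelta (δ : Q → A → Option Q) (q : Q) (a : A) : Q := (δ q a).getD q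

/-- Action of a word in a complete DFA. -/
def stepWordC (δc : Q → A → Q) (q : Q) (w : List A) : Q := w.foldl δc q

/-- The image of a set of states under the action of a word in a complete DFA. -/
def imgC (δc : Q → A → Q) (S : Set Q) (w : List A) : Set Q :=
  (fun q => stepWordC δc q w) '' S

end Defs

variable {A : Type*}

/-- `X` is a prefix code: no codeword is a prefix of another codeword. -/
def IsPrefixCode (X : Set (List A)) : Prop :=
  ∀ x ∈ X, ∀ y ∈ X, x <+: y → x = y

/-- The states of the literal automaton of `X`: proper prefixes of codewords
(the empty prefix `[]` is the root state). -/
def ProperPrefixes (X : Set (List A)) : Set (List A) :=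
  {q | ∃ x ∈ X, q <+: x ∧ q ≠ x}

/-- The transition function of the literal automaton `A_X`:
`δ(q,a) = qa` if `qa` is a proper prefix of a codeword, `δ(q,a) = ε` (the root) if
`qa ∈ X`, and `δ(q,a) = ⊥` otherwise. -/
noncomputable def litDelta (X : Set (List A)) (q : ProperPrefixes X) (a : A) :
    Option (ProperPrefixes X) :=
  if h : (q.val ++ [a]) ∈ ProperPrefixes X then some ⟨q.val ++ [a], h⟩
  else if h2 : (q.val ++ [a]) ∈ X then
    some ⟨[], ⟨q.val ++ [a], h2, List.nil_prefix, by simp⟩⟩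
  else none

section Words

variable {Q L : Type*}

theorem stepWord_append (δ : Q → L → Option Q) (q : Q) (u v : List L) :
    stepWord δ q (u ++ v) = (stepWord δ q u).bind (fun p => stepWord δ p v) := by
  induction u generalizing q with
  | nil => simp [stepWord]
  | cons a u ih => cases h : δ q a <;> simp [stepWord, h, ih]

theorem stepWord_append_eq_some {δ : Q → L → Option Q} {q r : Q} {u v : List L} :
    stepWord δ q (u ++ v) = some r ↔
      ∃ p, stepWord δ q u = some p ∧ stepWord δ p v = some r := by
  rw [stepWord_append, Option.bind_eq_some_iff]

theorem stepWord_singleton (δ : Q → L → Option Q) (q : Q) (a : L) :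
    stepWord δ q [a] = δ q a := by
  cases h : δ q a <;> simp [stepWord, h]

theorem Insep.symm {δ : Q → L → Option Q} {p q : Q} (h : Insep δ p q) : Insep δ q p :=
  fun u => (h u).symm

theorem Insep.trans {δ : Q → L → Option Q} {p q r : Q} (h : Insep δ p q) (h' : Insep δ q r) :
    Insep δ p r :=
  fun u => (h u).trans (h' u)

theorem Insep.of_stepWord {δ : Q → L → Option Q} {p q p' q' : Q} {u : List L} (h : Insep δ p q)
    (hp : stepWord δ p u = some p') (hq : stepWord δ q u = some q') : Insep δ p' q' := by
  intro v
  simpa [stepWord_append, hp, hq] using h (u ++ v)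

theorem Insep.exists_stepWord {δ : Q → L → Option Q} {p q p' : Q} {u : List L}
    (h : Insep δ p q) (hp : stepWord δ p u = some p') :
    ∃ q', stepWord δ q u = some q' ∧ Insep δ p' q' := by
  obtain ⟨q', hq⟩ := Option.isSome_iff_exists.1 ((h u).1 (by simp [hp]))
  exact ⟨q', hq, h.of_stepWord hp hq⟩

/-- The state has at least two outgoing letters. -/
def Branching (δ : Q → L → Option Q) (q : Q) : Prop :=
  ∃ a b, a ≠ b ∧ (δ q a).isSome ∧ (δ q b).isSome

/-- At least two letters are defined on some state of the set. -/
def HasChoice (δ : Q → L → Option Q) (P : Finset Q) : Prop :=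
  ∃ a b, a ≠ b ∧ (∃ q ∈ P, (δ q a).isSome) ∧ (∃ q ∈ P, (δ q b).isSome)

theorem HasChoice.nonempty {δ : Q → L → Option Q} {P : Finset Q} (h : HasChoice δ P) :
    P.Nonempty := by
  obtain ⟨a, b, -, ⟨q, hq, -⟩, -⟩ := h
  exact ⟨q, hq⟩

theorem HasChoice.of_branching {δ : Q → L → Option Q} {P : Finset Q} {q : Q} (hq : q ∈ P)
    (h : Branching δ q) : HasChoice δ P := by
  obtain ⟨a, b, hab, ha, hb⟩ := h
  exact ⟨a, b, hab, ⟨q, hq, ha⟩, ⟨q, hq, hb⟩⟩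

variable [Fintype Q]

/-- The image of a finite set of states under a word. -/
noncomputable def fimg (δ : Q → L → Option Q) (P : Finset Q) (w : List L) : Finset Q :=
  Finset.univ.filter (fun p => ∃ q ∈ P, stepWord δ q w = some p)

theorem mem_fimg {δ : Q → L → Option Q} {P : Finset Q} {w : List L} {p : Q} :
    p ∈ fimg δ P w ↔ ∃ q ∈ P, stepWord δ q w = some p := by
  simp [fimg]

theorem mem_fimg_singleton {δ : Q → L → Option Q} {P : Finset Q} {a : L} {p : Q} :
    p ∈ fimg δ P [a] ↔ ∃ q ∈ P, δ q a = some p := by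
  simp [mem_fimg, stepWord_singleton]

theorem fimg_nil (δ : Q → L → Option Q) (P : Finset Q) : fimg δ P [] = P := by
  ext p
  simp [mem_fimg, stepWord]

theorem fimg_append (δ : Q → L → Option Q) (P : Finset Q) (u v : List L) :
    fimg δ P (u ++ v) = fimg δ (fimg δ P u) v := by
  ext p
  simp only [mem_fimg, stepWord_append_eq_some]
  grind

theorem fimg_cons (δ : Q → L → Option Q) (P : Finset Q) (a : L) (v : List L) :
    fimg δ P (a :: v) = fimg δ (fimg δ P [a]) v :=
  fimg_append δ P [a] v

theorem fimg_union (δ : Q → L → Option Q) (P P' : Finset Q) (u : List L) :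
    fimg δ (P ∪ P') u = fimg δ P u ∪ fimg δ P' u := by
  ext p
  simp only [mem_fimg, Finset.mem_union]
  grind

theorem Finset.Nonempty.of_fimg {δ : Q → L → Option Q} {P : Finset Q} {u : List L}
    (h : (fimg δ P u).Nonempty) : P.Nonempty := by
  obtain ⟨p, hp⟩ := h
  obtain ⟨q, hq, -⟩ := mem_fimg.1 hp
  exact ⟨q, hq⟩

theorem fimg_subset_image_filter (δ : Q → L → Option Q) (P : Finset Q) (u : List L) :
    fimg δ P u ⊆
      (P.filter (fun q => (stepWord δ q u).isSome)).image (fun q => (stepWord δ q u).getD q) := by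
  intro p hp
  obtain ⟨q, hq, e⟩ := mem_fimg.1 hp
  exact Finset.mem_image.2 ⟨q, by simp [hq, e], by simp [e]⟩

theorem card_fimg_le_filter (δ : Q → L → Option Q) (P : Finset Q) (u : List L) :
    (fimg δ P u).card ≤ (P.filter (fun q => (stepWord δ q u).isSome)).card :=
  (Finset.card_le_card (fimg_subset_image_filter δ P u)).trans Finset.card_image_le

theorem card_fimg_le (δ : Q → L → Option Q) (P : Finset Q) (u : List L) :
    (fimg δ P u).card ≤ P.card :=
  (card_fimg_le_filter δ P u).trans (Finset.card_filter_le _ _)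

/-- Each nonbranching state survives at most one of two different letters, so one of them kills
at least half of the nonbranching states. -/
theorem HasChoice.exists_fimg_card_le {δ : Q → L → Option Q} {P : Finset Q}
    (h : HasChoice δ P) :
    ∃ a, (fimg δ P [a]).Nonempty ∧
      2 * (fimg δ P [a]).card + (P.filter (fun q => ¬ Branching δ q)).card ≤ 2 * P.card := by
  obtain ⟨a, b, hab, ⟨qa, hqa, ha⟩, ⟨qb, hqb, hb⟩⟩ := h
  obtain ⟨pa, hpa⟩ := Option.isSome_iff_exists.1 ha
  obtain ⟨pb, hpb⟩ := Option.isSome_iff_exists.1 hb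
  have key : ∀ x, (fimg δ P [x]).card +
      ((P.filter (fun q => ¬ Branching δ q)).filter (fun q => ¬ (δ q x).isSome)).card
        ≤ P.card := by
    intro x
    have h1 := card_fimg_le_filter δ P [x]
    have h2 := Finset.card_filter_add_card_filter_not (s := P)
      (fun q => ((stepWord δ q [x]).isSome : Prop))
    have h3 : ((P.filter (fun q => ¬ Branching δ q)).filter
        (fun q => ¬ (δ q x).isSome)).card ≤
        (P.filter (fun q => ¬ ((stepWord δ q [x]).isSome : Prop))).card := by
      apply Finset.card_le_card
      intro q
      simp only [Finset.mem_filter, stepWord_singleton]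
      tauto
    omega
  have hcov : (P.filter (fun q => ¬ Branching δ q)).card ≤
      ((P.filter (fun q => ¬ Branching δ q)).filter (fun q => ¬ (δ q a).isSome)).card +
      ((P.filter (fun q => ¬ Branching δ q)).filter (fun q => ¬ (δ q b).isSome)).card := by
    refine (Finset.card_le_card ?_).trans (Finset.card_union_le _ _)
    intro q hq
    have hn := (Finset.mem_filter.1 hq).2
    simp only [Finset.mem_union, Finset.mem_filter (s := P.filter _)]
    by_contra hc
    push Not at hc
    exact hn ⟨a, b, hab, by simpa using hc.1 hq, by simpa using hc.2 hq⟩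
  have ka := key a
  have kb := key b
  have na : (fimg δ P [a]).Nonempty := ⟨pa, mem_fimg_singleton.2 ⟨qa, hqa, hpa⟩⟩
  have nb : (fimg δ P [b]).Nonempty := ⟨pb, mem_fimg_singleton.2 ⟨qb, hqb, hpb⟩⟩
  by_cases hc : 2 * (fimg δ P [a]).card + (P.filter (fun q => ¬ Branching δ q)).card ≤ 2 * P.card
  · exact ⟨a, na, hc⟩
  · exact ⟨b, nb, by omega⟩

theorem exists_hasChoice_fimg {δ : Q → L → Option Q} {p b : Q} {v : List L}
    (hb : Branching δ b) (hv : stepWord δ p v = some b) {P : Finset Q} (hp : p ∈ P) :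
    HasChoice δ (fimg δ P v) :=
  HasChoice.of_branching (mem_fimg.2 ⟨p, hp, hv⟩) hb

end Words

section Krylov

variable {E L : Type*} [AddCommGroup E] [Module ℚ E]

/-- The composition of a word of linear operators; the first letter is applied last. -/
def opWord (T : L → E →ₗ[ℚ] E) : List L → E →ₗ[ℚ] E
  | [] => LinearMap.id
  | a :: u => (T a).comp (opWord T u)

variable [FiniteDimensional ℚ E]

/-- A linear functional vanishing on the images of a vector under all words of length at most the
dimension vanishes on the images under all words. -/
theorem apply_opWord_eq_zero (T : L → E →ₗ[ℚ] E) (y : E) (φ : E →ₗ[ℚ] ℚ)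
    (h : ∀ u : List L, u.length ≤ Module.finrank ℚ E → φ (opWord T u y) = 0) (u : List L) :
    φ (opWord T u y) = 0 := by
  set U : ℕ → Submodule ℚ E := fun j =>
    Submodule.span ℚ {z | ∃ u : List L, u.length ≤ j ∧ opWord T u y = z} with hU
  have mem : ∀ j (u : List L), u.length ≤ j → opWord T u y ∈ U j := fun j u hu =>
    Submodule.subset_span ⟨u, hu, rfl⟩
  have mono : ∀ j, U j ≤ U (j + 1) := by
    intro j
    refine Submodule.span_mono ?_
    rintro z ⟨u, hu, rfl⟩
    exact ⟨u, by omega, rfl⟩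
  have stab : ∀ j, U (j + 1) ≤ U j → ∀ u : List L, opWord T u y ∈ U j := by
    intro j hj u
    induction u with
    | nil => exact mem j [] (by simp)
    | cons a u ih =>
      have hle : U j ≤ (U (j + 1)).comap (T a) := by
        refine Submodule.span_le.2 ?_
        rintro z ⟨v, hv, rfl⟩
        exact mem (j + 1) (a :: v) (by simpa using hv)
      exact hj (hle ih)
  obtain ⟨j, hjn, hj⟩ : ∃ j ≤ Module.finrank ℚ E, U (j + 1) ≤ U j := by
    by_contra! hc
    have grow : ∀ j ≤ Module.finrank ℚ E + 1, j ≤ Module.finrank ℚ (U j) := by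
      intro j
      induction j with
      | zero => simp
      | succ j ih =>
        intro hj
        have := Submodule.finrank_lt_finrank_of_lt
          (lt_of_le_not_ge (mono j) (hc j (by omega)))
        have := ih (by omega)
        omega
    have h1 := grow _ le_rfl
    have h2 := Submodule.finrank_le (U (Module.finrank ℚ E + 1))
    omega
  have hker : U j ≤ LinearMap.ker φ := by
    refine Submodule.span_le.2 ?_
    rintro z ⟨v, hv, rfl⟩
    exact h v (hv.trans hjn)
  exact hker (stab j hj u)

end Krylov

section Separation

variable {Q L : Type*}

/-- The action of a letter on rational functions on the states. -/
def letterOp (δ : Q → L → Option Q) (a : L) : (Q → ℚ) →ₗ[ℚ] (Q → ℚ) where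
  toFun y q := (δ q a).elim 0 y
  map_add' y z := by
    ext q
    cases h : δ q a <;> simp [h]
  map_smul' c y := by
    ext q
    cases h : δ q a <;> simp [h]

theorem opWord_letterOp (δ : Q → L → Option Q) (u : List L) (y : Q → ℚ) (q : Q) :
    opWord (letterOp δ) u y q = (stepWord δ q u).elim 0 y := by
  induction u generalizing q with
  | nil => simp [opWord, stepWord]
  | cons a u ih =>
    show (δ q a).elim 0 (opWord (letterOp δ) u y) = _
    cases h : δ q a <;> simp [stepWord, h, ih]

variable [Fintype Q]

theorem exists_short_separating {δ : Q → L → Option Q} {p q : Q} (h : ¬ Insep δ p q) :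
    ∃ u : List L, u.length ≤ Fintype.card Q ∧
      ¬ ((stepWord δ p u).isSome ↔ (stepWord δ q u).isSome) := by
  by_contra! hc
  apply h
  set ψ : (Q → ℚ) →ₗ[ℚ] ℚ :=
    LinearMap.proj (R := ℚ) (φ := fun _ => ℚ) p - LinearMap.proj (R := ℚ) (φ := fun _ => ℚ) q
  have ev : ∀ u : List L, ψ (opWord (letterOp δ) u (fun _ => 1)) =
      (stepWord δ p u).elim 0 (fun _ => 1) - (stepWord δ q u).elim 0 (fun _ => 1) := fun u => by
    rw [← opWord_letterOp, ← opWord_letterOp]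
    rfl
  have key := apply_opWord_eq_zero (letterOp δ) (fun _ => 1) ψ (by
    intro u hu
    rw [Module.finrank_fintype_fun_eq_card] at hu
    have := hc u hu
    rw [ev]
    cases h1 : stepWord δ p u <;> cases h2 : stepWord δ q u <;> simp_all)
  intro u
  have := key u
  rw [ev] at this
  cases h1 : stepWord δ p u <;> cases h2 : stepWord δ q u <;> simp_all

theorem exists_insep_fimg (δ : Q → L → Option Q) (P : Finset Q) (hP : P.Nonempty) :
    ∃ u : List L, u.length ≤ P.card * Fintype.card Q ∧ (fimg δ P u).Nonempty ∧
      ∀ p ∈ fimg δ P u, ∀ q ∈ fimg δ P u, Insep δ p q := by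
  induction hN : P.card using Nat.strong_induction_on generalizing P with
  | _ N ih =>
    subst hN
    by_cases hI : ∀ p ∈ P, ∀ q ∈ P, Insep δ p q
    · exact ⟨[], by simp, by simpa [fimg_nil] using hP, by simpa [fimg_nil] using hI⟩
    push Not at hI
    obtain ⟨p, hp, q, hq, hpq⟩ := hI
    obtain ⟨u, hu, hs⟩ := exists_short_separating hpq
    have hlt : (fimg δ P u).card < P.card := by
      refine (card_fimg_le_filter δ P u).trans_lt (Finset.card_lt_card ?_)
      rw [Finset.filter_ssubset]
      by_contra! hc
      exact hs ⟨fun _ => hc q hq, fun _ => hc p hp⟩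
    have hne : (fimg δ P u).Nonempty := by
      by_contra hc
      rw [Finset.not_nonempty_iff_eq_empty] at hc
      have hnone : ∀ r ∈ P, stepWord δ r u = none := by
        intro r hr
        by_contra hr'
        obtain ⟨t, ht⟩ := Option.ne_none_iff_exists'.1 hr'
        have : t ∈ fimg δ P u := mem_fimg.2 ⟨r, hr, ht⟩
        simp [hc] at this
      exact hs (by simp [hnone p hp, hnone q hq])
    obtain ⟨v, hv, hv1, hv2⟩ := ih _ hlt _ hne rfl
    refine ⟨u ++ v, ?_, by rwa [fimg_append], by rwa [fimg_append]⟩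
    rw [List.length_append]
    have := Nat.mul_le_mul_right (Fintype.card Q) (Nat.succ_le_of_lt hlt)
    rw [Nat.succ_mul] at this
    omega

end Separation

section RootedTree

variable {Q L : Type*}

/-- The weight passed on by a letter when it does not lead to the root. -/
noncomputable def childWeight (δ : Q → L → Option Q) (root : Q) (size : Q → ℕ) (q : Q) (a : L) :
    ℕ :=
  (δ q a).elim 0 (fun p => if p = root then 0 else size p)

/-- A partial automaton all of whose cycles pass through the root of a tree, where `depth` is the
depth of a state and `size` the number of states in the subtree below it. -/
structure IsRootedTree [Fintype Q] (δ : Q → L → Option Q) (root : Q) (depth size : Q → ℕ) :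
    Prop where
  depth_lt : ∀ q, depth q < Fintype.card Q
  depth_step : ∀ q a p, δ q a = some p → p ≠ root → depth p = depth q + 1
  size_pos : ∀ q, 0 < size q
  size_le : ∀ q, size q ≤ Fintype.card Q
  childWeight_le : ∀ q a, childWeight δ root size q a ≤ size q
  childWeight_add_le : ∀ q a b, a ≠ b →
    childWeight δ root size q a + childWeight δ root size q b ≤ size q
  to_root : ∀ q, ∃ u : List L, u.length ≤ Fintype.card Q ∧ stepWord δ q u = some root
  from_root : ∀ q, ∃ u : List L, u.length ≤ Fintype.card Q ∧ stepWord δ root u = some q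

/-- Some successor of a state; the unique one if there is only one outgoing letter. -/
noncomputable def someSucc (δ : Q → L → Option Q) (q : Q) : Q :=
  if h : ∃ p a, δ q a = some p then h.choose else q

theorem someSucc_eq {δ : Q → L → Option Q} {q p : Q} {a : L} (hq : ¬ Branching δ q)
    (h : δ q a = some p) : someSucc δ q = p := by
  have hex : ∃ p a, δ q a = some p := ⟨p, a, h⟩
  obtain ⟨b, hb⟩ := hex.choose_spec
  have hs : someSucc δ q = hex.choose := dif_pos hex
  have hab : a = b := by
    by_contra hab
    exact hq ⟨a, b, hab, by simp [h], by simp [hb]⟩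
  subst hab
  rw [hs]
  exact Option.some.inj (hb.symm.trans h)

/-- The states on the path of nonbranching states that starts at the root. -/
def OnChain (δ : Q → L → Option Q) (root q : Q) : Prop :=
  ∃ i : ℕ, (someSucc δ)^[i] root = q ∧ ∀ j < i, ¬ Branching δ ((someSucc δ)^[j] root)

theorem OnChain.root (δ : Q → L → Option Q) (r : Q) : OnChain δ r r :=
  ⟨0, rfl, by simp⟩

theorem OnChain.step {δ : Q → L → Option Q} {root q p : Q} {a : L} (hq : OnChain δ root q)
    (hn : ¬ Branching δ q) (h : δ q a = some p) : OnChain δ root p := by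
  obtain ⟨i, hi, hj⟩ := hq
  refine ⟨i + 1, ?_, fun j hj' => ?_⟩
  · rw [Function.iterate_succ_apply', hi, someSucc_eq hn h]
  · rcases Nat.lt_succ_iff_lt_or_eq.1 hj' with h' | rfl
    · exact hj j h'
    · rwa [hi]

theorem OnChain.eq_of_branching {δ : Q → L → Option Q} {root p q : Q} (hp : OnChain δ root p)
    (hq : OnChain δ root q) (hbp : Branching δ p) (hbq : Branching δ q) : p = q := by
  obtain ⟨i, rfl, hi⟩ := hp
  obtain ⟨j, rfl, hj⟩ := hq
  rcases lt_trichotomy i j with h | rfl | h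
  · exact absurd hbp (hj i h)
  · rfl
  · exact absurd hbq (hi j h)

theorem card_onChain_le {δ : Q → L → Option Q} {root : Q} {F P : Finset Q} (hFP : F ⊆ P)
    (hF : ∀ q ∈ F, OnChain δ root q) :
    F.card ≤ (P.filter (fun q => ¬ Branching δ q)).card + 1 := by
  have h1 := Finset.card_filter_add_card_filter_not (s := F) (fun q => Branching δ q)
  have h2 : (F.filter (fun q => Branching δ q)).card ≤ 1 := by
    refine Finset.card_le_one.2 fun p hp q hq => ?_
    rw [Finset.mem_filter] at hp hq
    exact (hF p hp.1).eq_of_branching (hF q hq.1) hp.2 hq.2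
  have h3 : (F.filter (fun q => ¬ Branching δ q)).card ≤
      (P.filter (fun q => ¬ Branching δ q)).card :=
    Finset.card_le_card (Finset.filter_subset_filter _ hFP)
  omega

theorem card_union_le_or {δ : Q → L → Option Q} {root : Q} (m : ℕ) {F D : Finset Q}
    (hF : ∀ q ∈ F, OnChain δ root q) :
    m < ((F ∪ D).filter (fun q => ¬ Branching δ q)).card ∨ (F ∪ D).card ≤ D.card + (m + 1) := by
  have h1 := card_onChain_le (P := F ∪ D) Finset.subset_union_left hF
  have h2 := Finset.card_union_le F D
  omega

variable [Fintype Q] {δ : Q → L → Option Q} {root : Q} {depth size : Q → ℕ}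

theorem fimg_onChain_of_not_hasChoice {F P : Finset Q} (hFP : F ⊆ P) (hP : ¬ HasChoice δ P)
    (hF : ∀ q ∈ F, OnChain δ root q) (a : L) : ∀ q ∈ fimg δ F [a], OnChain δ root q := by
  intro q hq
  obtain ⟨p, hp, e⟩ := mem_fimg_singleton.1 hq
  exact (hF p hp).step (fun hb => hP (HasChoice.of_branching (hFP hp) hb)) e

/-- Reading letters up to the next choice when all tracked states are on the chain. -/
theorem exists_fimg_card_le_of_onChain (m : ℕ) (v : List L) (F D : Finset Q)
    (hF : ∀ q ∈ F, OnChain δ root q) (hv : HasChoice δ (fimg δ (F ∪ D) v)) :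
    ∃ u : List L, u.length ≤ v.length ∧ (fimg δ (F ∪ D) u).Nonempty ∧
      ((HasChoice δ (fimg δ (F ∪ D) u) ∧
          m < ((fimg δ (F ∪ D) u).filter (fun q => ¬ Branching δ q)).card) ∨
        (fimg δ (F ∪ D) u).card ≤ D.card + (m + 1)) := by
  induction v generalizing F D with
  | nil =>
    refine ⟨[], le_rfl, hv.nonempty, ?_⟩
    rw [fimg_nil] at hv ⊢
    exact (card_union_le_or m hF).imp_left fun h => ⟨hv, h⟩
  | cons a v ih =>
    by_cases hc : HasChoice δ (F ∪ D)
    · refine ⟨[], by simp, by simpa only [fimg_nil] using hc.nonempty, ?_⟩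
      rw [fimg_nil]
      exact (card_union_le_or m hF).imp_left fun h => ⟨hc, h⟩
    · rw [fimg_cons, fimg_union] at hv
      obtain ⟨u, hu, hne, h⟩ := ih _ _
        (fimg_onChain_of_not_hasChoice Finset.subset_union_left hc hF a) hv
      rw [← fimg_union, ← fimg_cons] at hne h
      refine ⟨a :: u, by simpa using hu, hne, h.imp_right fun h => h.trans ?_⟩
      have := card_fimg_le δ D [a]
      omega

theorem sum_fimg_erase_le (V : Finset Q) (a : L) :
    ∑ p ∈ (fimg δ V [a]).erase root, size p ≤ ∑ q ∈ V, childWeight δ root size q a := by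
  have hsub : (fimg δ V [a]).erase root ⊆
      (V.filter (fun q => ∃ p, δ q a = some p ∧ p ≠ root)).image (fun q => (δ q a).getD q) := by
    intro p hp
    obtain ⟨hpr, hp⟩ := Finset.mem_erase.1 hp
    obtain ⟨q, hq, e⟩ := mem_fimg_singleton.1 hp
    exact Finset.mem_image.2 ⟨q, Finset.mem_filter.2 ⟨hq, p, e, hpr⟩, by simp [e]⟩
  calc ∑ p ∈ (fimg δ V [a]).erase root, size p
      ≤ ∑ p ∈ (V.filter (fun q => ∃ p, δ q a = some p ∧ p ≠ root)).image
          (fun q => (δ q a).getD q), size p := Finset.sum_le_sum_of_subset hsub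
    _ ≤ ∑ q ∈ V.filter (fun q => ∃ p, δ q a = some p ∧ p ≠ root), size ((δ q a).getD q) :=
        Finset.sum_image_le_of_nonneg (fun _ _ => Nat.zero_le _)
    _ = ∑ q ∈ V.filter (fun q => ∃ p, δ q a = some p ∧ p ≠ root),
          childWeight δ root size q a := by
        refine Finset.sum_congr rfl fun q hq => ?_
        obtain ⟨-, p, e, hpr⟩ := Finset.mem_filter.1 hq
        simp [childWeight, e, hpr]
    _ ≤ _ := Finset.sum_le_sum_of_subset (Finset.filter_subset _ _)

theorem le_depth_of_mem_fimg_erase (h : IsRootedTree δ root depth size) {V : Finset Q} {k n : ℕ}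
    (hV : ∀ q ∈ V, n ≤ depth q + (k + 1)) (a : L) :
    ∀ p ∈ (fimg δ V [a]).erase root, n ≤ depth p + k := by
  intro p hp
  obtain ⟨hpr, hp⟩ := Finset.mem_erase.1 hp
  obtain ⟨q, hq, e⟩ := mem_fimg_singleton.1 hp
  have := h.depth_step q a p e hpr
  have := hV q hq
  omega

theorem fimg_eq_erase_union_filter (V : Finset Q) (a : L) :
    fimg δ V [a] = (fimg δ V [a]).erase root ∪ (fimg δ V [a]).filter (· = root) := by
  ext p
  simp only [Finset.mem_union, Finset.mem_erase, Finset.mem_filter]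
  tauto

/-- `V` holds the states that have not yet visited the root, `F` those that have visited it since
the last choice, and `D` the remaining ones. -/
theorem exists_fimg_card_le (h : IsRootedTree δ root depth size) {n N : ℕ}
    (hn : n = Fintype.card Q)
    (good : ∀ P : Finset Q, P.Nonempty → ∃ v : List L, v.length ≤ N ∧ HasChoice δ (fimg δ P v))
    (m k K : ℕ) (V F D : Finset Q) (hne : (V ∪ (F ∪ D)).Nonempty)
    (hV : ∀ q ∈ V, n ≤ depth q + k) (hK : ∑ q ∈ V, size q < 2 ^ K)
    (hF : ∀ q ∈ F, OnChain δ root q) :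
    ∃ u : List L, u.length ≤ k + N ∧ (fimg δ (V ∪ (F ∪ D)) u).Nonempty ∧
      ((HasChoice δ (fimg δ (V ∪ (F ∪ D)) u) ∧
          m < ((fimg δ (V ∪ (F ∪ D)) u).filter (fun q => ¬ Branching δ q)).card) ∨
        (fimg δ (V ∪ (F ∪ D)) u).card ≤ D.card + (K + 1) * (m + 1)) := by
  induction k generalizing V F D K with
  | zero =>
    obtain rfl : V = ∅ := by
      refine Finset.eq_empty_of_forall_notMem fun q hq => ?_
      have := h.depth_lt q
      have := hV q hq
      omega
    rw [Finset.empty_union] at hne ⊢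
    obtain ⟨v, hv, hc⟩ := good _ hne
    obtain ⟨u, hu, hne', hu'⟩ := exists_fimg_card_le_of_onChain m v F D hF hc
    refine ⟨u, by omega, hne', hu'.imp_right fun h => h.trans ?_⟩
    gcongr
    exact Nat.le_mul_of_pos_left _ (by omega)
  | succ k ih =>
    by_cases hVe : V = ∅
    · subst hVe
      rw [Finset.empty_union] at hne ⊢
      obtain ⟨v, hv, hc⟩ := good _ hne
      obtain ⟨u, hu, hne', hu'⟩ := exists_fimg_card_le_of_onChain m v F D hF hc
      refine ⟨u, by omega, hne', hu'.imp_right fun h => h.trans ?_⟩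
      gcongr
      exact Nat.le_mul_of_pos_left _ (by omega)
    set P := V ∪ (F ∪ D) with hP
    have hFP : F ⊆ P := Finset.subset_union_left.trans Finset.subset_union_right
    by_cases hc : HasChoice δ P
    · by_cases hm : m < (P.filter (fun q => ¬ Branching δ q)).card
      · exact ⟨[], by simp, by simpa only [fimg_nil] using hne, by
          simpa only [fimg_nil] using Or.inl ⟨hc, hm⟩⟩
      have hFc := card_onChain_le hFP hF
      obtain ⟨K, rfl⟩ : ∃ K', K = K' + 1 := by
        refine Nat.exists_eq_succ_of_ne_zero ?_
        rintro rfl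
        obtain ⟨q, hq⟩ := Finset.nonempty_iff_ne_empty.2 hVe
        have := Finset.single_le_sum (f := size) (fun _ _ => Nat.zero_le _) hq
        have := h.size_pos q
        simp only [pow_zero] at hK
        omega
      obtain ⟨x, hx, hxw⟩ : ∃ x, (∃ q ∈ P, (δ q x).isSome) ∧
          ∑ p ∈ (fimg δ V [x]).erase root, size p < 2 ^ K := by
        obtain ⟨a, b, hab, ha, hb⟩ := hc
        have h1 := sum_fimg_erase_le (δ := δ) (root := root) (size := size) V a
        have h2 := sum_fimg_erase_le (δ := δ) (root := root) (size := size) V b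
        have h3 : ∑ q ∈ V, childWeight δ root size q a + ∑ q ∈ V, childWeight δ root size q b
            ≤ ∑ q ∈ V, size q := by
          rw [← Finset.sum_add_distrib]
          exact Finset.sum_le_sum fun q _ => h.childWeight_add_le q a b hab
        rw [pow_succ] at hK
        by_cases hlt : ∑ p ∈ (fimg δ V [a]).erase root, size p < 2 ^ K
        · exact ⟨a, ha, hlt⟩
        · exact ⟨b, hb, by omega⟩
      have hPx : fimg δ P [x] = (fimg δ V [x]).erase root ∪
          ((fimg δ V [x]).filter (· = root) ∪ fimg δ (F ∪ D) [x]) := by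
        rw [hP, fimg_union, ← Finset.union_assoc, ← fimg_eq_erase_union_filter]
      have hPne : (fimg δ P [x]).Nonempty := by
        obtain ⟨q, hq, hs⟩ := hx
        obtain ⟨p, hp⟩ := Option.isSome_iff_exists.1 hs
        exact ⟨p, mem_fimg_singleton.2 ⟨q, hq, hp⟩⟩
      obtain ⟨u, hu, hne', hu'⟩ := ih K _ ((fimg δ V [x]).filter (· = root)) (fimg δ (F ∪ D) [x])
        (hPx ▸ hPne) (le_depth_of_mem_fimg_erase h hV x) hxw (by
          intro q hq
          rw [(Finset.mem_filter.1 hq).2]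
          exact OnChain.root δ root)
      rw [← hPx, ← fimg_cons] at hne' hu'
      refine ⟨x :: u, by simp only [List.length_cons]; omega, hne',
        hu'.imp_right fun h => h.trans ?_⟩
      have h1 := card_fimg_le δ (F ∪ D) [x]
      have h2 := Finset.card_union_le F D
      rw [Nat.succ_mul (K + 1)]
      omega
    · obtain ⟨x, hPne⟩ : ∃ x, (fimg δ P [x]).Nonempty := by
        obtain ⟨v, -, hv⟩ := good P hne
        cases v with
        | nil => exact absurd (by rwa [fimg_nil] at hv) hc
        | cons x v =>
          rw [fimg_cons] at hv
          exact ⟨x, hv.nonempty.of_fimg⟩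
      have hPx : fimg δ P [x] = (fimg δ V [x]).erase root ∪
          (((fimg δ V [x]).filter (· = root) ∪ fimg δ F [x]) ∪ fimg δ D [x]) := by
        rw [hP, fimg_union, fimg_union, Finset.union_assoc ((fimg δ V [x]).filter (· = root)),
          ← Finset.union_assoc ((fimg δ V [x]).erase root), ← fimg_eq_erase_union_filter]
      obtain ⟨u, hu, hne', hu'⟩ := ih K _ ((fimg δ V [x]).filter (· = root) ∪ fimg δ F [x])
        (fimg δ D [x]) (hPx ▸ hPne) (le_depth_of_mem_fimg_erase h hV x)
        (((sum_fimg_erase_le V x).trans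
          (Finset.sum_le_sum fun q _ => h.childWeight_le q x)).trans_lt hK) (by
          intro q hq
          rcases Finset.mem_union.1 hq with hq | hq
          · rw [(Finset.mem_filter.1 hq).2]
            exact OnChain.root δ root
          · exact fimg_onChain_of_not_hasChoice hFP hc hF x q hq)
      rw [← hPx, ← fimg_cons] at hne' hu'
      refine ⟨x :: u, by simp only [List.length_cons]; omega, hne',
        hu'.imp_right fun h => h.trans ?_⟩
      have := card_fimg_le δ D [x]
      omega

end RootedTree

section Compression

variable {Q L : Type*} [Fintype Q] {δ : Q → L → Option Q} {root : Q} {depth size : Q → ℕ}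

theorem IsRootedTree.exists_stepWord (h : IsRootedTree δ root depth size) (p q : Q) :
    ∃ u : List L, u.length ≤ 2 * Fintype.card Q ∧ stepWord δ p u = some q := by
  obtain ⟨u, hu, e⟩ := h.to_root p
  obtain ⟨v, hv, e'⟩ := h.from_root q
  exact ⟨u ++ v, by rw [List.length_append]; omega, stepWord_append_eq_some.2 ⟨_, e, e'⟩⟩

theorem IsRootedTree.exists_fimg_card_le (h : IsRootedTree δ root depth size) {b : Q}
    (hb : Branching δ b) {M : ℕ} (hM : Fintype.card Q ^ 2 < 2 ^ M) (m : ℕ) {P : Finset Q}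
    (hP : P.Nonempty) :
    ∃ u : List L, u.length ≤ 3 * Fintype.card Q ∧ (fimg δ P u).Nonempty ∧
      ((HasChoice δ (fimg δ P u) ∧
          m < ((fimg δ P u).filter (fun q => ¬ Branching δ q)).card) ∨
        (fimg δ P u).card ≤ (M + 1) * (m + 1)) := by
  have hsum : ∑ q ∈ P, size q < 2 ^ M := by
    refine lt_of_le_of_lt ?_ hM
    calc ∑ q ∈ P, size q ≤ P.card * Fintype.card Q :=
          Finset.sum_le_card_nsmul _ _ _ fun q _ => h.size_le q
      _ ≤ Fintype.card Q ^ 2 := by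
          rw [sq]
          exact Nat.mul_le_mul_right _ (Finset.card_le_univ P)
  obtain ⟨u, hu, hu'⟩ := _root_.exists_fimg_card_le h (n := Fintype.card Q)
    (N := 2 * Fintype.card Q) rfl (by
      rintro P ⟨p, hp⟩
      obtain ⟨v, hv, e⟩ := h.exists_stepWord p b
      exact ⟨v, hv, exists_hasChoice_fimg hb e hp⟩)
    m (Fintype.card Q) M P ∅ ∅ (by simpa using hP) (by simp) hsum (by simp)
  exact ⟨u, by omega, by simpa using hu'⟩

theorem IsRootedTree.exists_fimg_card_le_or (h : IsRootedTree δ root depth size) {b : Q}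
    (hb : Branching δ b) {M : ℕ} (hM : Fintype.card Q ^ 2 < 2 ^ M) (m : ℕ) {P : Finset Q}
    (hP : P.Nonempty) :
    ∃ u : List L, u.length ≤ 3 * Fintype.card Q + 1 ∧ (fimg δ P u).Nonempty ∧
      (2 * (fimg δ P u).card + (m + 1) ≤ 2 * P.card ∨
        (fimg δ P u).card ≤ (M + 1) * (m + 1)) := by
  obtain ⟨u, hu, hne, ⟨hc, hm⟩ | hu'⟩ := h.exists_fimg_card_le hb hM m hP
  · obtain ⟨a, ha, hle⟩ := hc.exists_fimg_card_le
    rw [← fimg_append] at ha hle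
    have := card_fimg_le δ P u
    exact ⟨u ++ [a], by simpa using hu, ha, Or.inl (by omega)⟩
  · exact ⟨u, by omega, hne, Or.inr hu'⟩

theorem IsRootedTree.exists_fimg_card_le_of_le_add (h : IsRootedTree δ root depth size) {b : Q}
    (hb : Branching δ b) {M : ℕ} (hM : Fintype.card Q ^ 2 < 2 ^ M) {m : ℕ} (hm : 0 < m) (j : ℕ)
    {P : Finset Q} (hP : P.Nonempty) (hcard : 2 * P.card ≤ 2 * ((M + 1) * m) + j * m) :
    ∃ u : List L, u.length ≤ j * (3 * Fintype.card Q + 1) ∧ (fimg δ P u).Nonempty ∧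
      (fimg δ P u).card ≤ (M + 1) * m := by
  induction j generalizing P with
  | zero => exact ⟨[], by simp, by simpa only [fimg_nil] using hP, by
      rw [fimg_nil]
      omega⟩
  | succ j ih =>
    obtain ⟨u, hu, hne, hu'⟩ := h.exists_fimg_card_le_or hb hM (m - 1) hP
    rw [Nat.sub_add_cancel hm] at hu'
    rw [Nat.succ_mul j] at hcard ⊢
    rcases hu' with hu' | hu'
    · obtain ⟨v, hv, hvne, hvc⟩ := ih hne (by omega)
      rw [← fimg_append] at hvne hvc
      exact ⟨u ++ v, by rw [List.length_append]; omega, hvne, hvc⟩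
    · exact ⟨u, by omega, hne, hu'⟩

theorem IsRootedTree.exists_fimg_card_le_of_le_two_pow (h : IsRootedTree δ root depth size) {b : Q}
    (hb : Branching δ b) {M : ℕ} (hM : Fintype.card Q ^ 2 < 2 ^ M) (k : ℕ)
    {P : Finset Q} (hP : P.Nonempty) (hcard : P.card ≤ (M + 1) * 2 ^ k) :
    ∃ u : List L, u.length ≤ k * (2 * (M + 1) * (3 * Fintype.card Q + 1)) ∧
      (fimg δ P u).Nonempty ∧ (fimg δ P u).card ≤ M + 1 := by
  induction k generalizing P with
  | zero => exact ⟨[], by simp, by simpa only [fimg_nil] using hP, by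
      simpa only [fimg_nil, pow_zero, mul_one] using hcard⟩
  | succ k ih =>
    obtain ⟨u, hu, hne, hu'⟩ := h.exists_fimg_card_le_of_le_add hb hM (m := 2 ^ k)
      (by positivity) (2 * (M + 1)) hP (by rw [pow_succ] at hcard; linarith)
    obtain ⟨v, hv, hvne, hvc⟩ := ih hne hu'
    rw [← fimg_append] at hvne hvc
    exact ⟨u ++ v, by rw [List.length_append, Nat.succ_mul]; omega, hvne, hvc⟩

/-- Inseparable states branch simultaneously, so the states inseparable from the root are
compressed by a short word to logarithmically many states. -/
theorem IsRootedTree.exists_fimg_insep_root_card_le (h : IsRootedTree δ root depth size) {b : Q}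
    (hb : Branching δ b) {M : ℕ} (hM : Fintype.card Q ^ 2 < 2 ^ M) :
    ∃ w : List L, w.length ≤ 3 * Fintype.card Q ∧
      (fimg δ (Finset.univ.filter (fun q => Insep δ root q)) w).Nonempty ∧
      (fimg δ (Finset.univ.filter (fun q => Insep δ root q)) w).card ≤ M + 1 := by
  obtain ⟨u, hu, hne, ⟨⟨a, c, hac, ⟨p, hp, hpa⟩, ⟨q, hq, hqc⟩⟩, hm⟩ | hu'⟩ :=
    h.exists_fimg_card_le hb hM 0 (P := Finset.univ.filter (fun q => Insep δ root q))
      ⟨root, by simp [Insep]⟩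
  · obtain ⟨r, hr⟩ := Finset.card_pos.1 hm
    obtain ⟨hr, hrn⟩ := Finset.mem_filter.1 hr
    have hI : ∀ s ∈ fimg δ (Finset.univ.filter (fun q => Insep δ root q)) u, Insep δ s r := by
      intro s hs
      obtain ⟨s', hs', es⟩ := mem_fimg.1 hs
      obtain ⟨r', hr', er⟩ := mem_fimg.1 hr
      have h1 : Insep δ root s' := (Finset.mem_filter.1 hs').2
      have h2 : Insep δ root r' := (Finset.mem_filter.1 hr').2
      exact (h1.symm.trans h2).of_stepWord es er
    refine absurd ⟨a, c, hac, ?_, ?_⟩ hrn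
    · have := (hI p hp [a]).1
      simpa only [stepWord_singleton, hpa, forall_true_left] using this
    · have := (hI q hq [c]).1
      simpa only [stepWord_singleton, hqc, forall_true_left] using this
  · exact ⟨u, hu, hne, by simpa using hu'⟩

end Compression

section NoBranching

variable {Q L : Type*} {δ : Q → L → Option Q}

theorem stepWord_eq_iterate_someSucc (hb : ∀ q, ¬ Branching δ q) {p q : Q} {u : List L}
    (h : stepWord δ p u = some q) : q = (someSucc δ)^[u.length] p := by
  induction u generalizing p with
  | nil => simpa [stepWord, eq_comm] using h
  | cons a u ih =>
    obtain ⟨r, hr, e⟩ := (stepWord_append_eq_some (u := [a])).1 h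
    rw [stepWord_singleton] at hr
    rw [List.length_cons, Function.iterate_succ_apply, someSucc_eq (hb p) hr]
    exact ih e

theorem someSucc_surjective [Nontrivial Q] (hb : ∀ q, ¬ Branching δ q)
    (hs : StronglyConnected δ) : Function.Surjective (someSucc δ) := by
  intro q
  obtain ⟨p, hpq⟩ := exists_ne q
  obtain ⟨w, hw⟩ := hs p q
  have e := stepWord_eq_iterate_someSucc hb hw
  cases hl : w.length with
  | zero =>
    rw [hl] at e
    exact absurd e.symm hpq
  | succ k =>
    rw [hl, Function.iterate_succ_apply'] at e
    exact ⟨_, e.symm⟩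

theorem eq_of_insep_of_not_branching [Finite Q] [Nontrivial Q] (hb : ∀ q, ¬ Branching δ q)
    (hs : StronglyConnected δ) {z : List L} {d e : Q} (hd : stepWord δ d z = some e)
    (hz : ∀ q r, stepWord δ q z = some r → r = e) {p q : Q} (hpq : Insep δ p q) : p = q := by
  obtain ⟨u, hu⟩ := hs p d
  have h1 : stepWord δ p (u ++ z) = some e := stepWord_append_eq_some.2 ⟨d, hu, hd⟩
  obtain ⟨r, h2, -⟩ := hpq.exists_stepWord h1
  obtain ⟨q', -, hr⟩ := stepWord_append_eq_some.1 h2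
  obtain rfl := hz _ _ hr
  have hinj := (Finite.injective_iff_surjective.2 (someSucc_surjective hb hs)).iterate
    (u ++ z).length
  exact hinj ((stepWord_eq_iterate_someSucc hb h1).symm.trans (stepWord_eq_iterate_someSucc hb h2))

variable [Fintype Q]

theorem exists_hasChoice_of_separating (hout : ∀ q, ∃ a, (δ q a).isSome) {p q : Q} {u : List L}
    (hu : ¬ ((stepWord δ p u).isSome ↔ (stepWord δ q u).isSome)) {P : Finset Q} (hp : p ∈ P)
    (hq : q ∈ P) : ∃ v : List L, v.length ≤ u.length ∧ HasChoice δ (fimg δ P v) := by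
  induction u generalizing p q P with
  | nil => simp [stepWord] at hu
  | cons a u ih =>
    have here : ∀ {p q : Q}, p ∈ P → q ∈ P → (δ p a).isSome → δ q a = none →
        ∃ v : List L, v.length ≤ (a :: u).length ∧ HasChoice δ (fimg δ P v) := by
      intro p q hp hq h1 h2
      obtain ⟨c, hc⟩ := hout q
      refine ⟨[], by simp, ?_⟩
      rw [fimg_nil]
      refine ⟨a, c, ?_, ⟨p, hp, h1⟩, ⟨q, hq, hc⟩⟩
      rintro rfl
      simp [h2] at hc
    cases h1 : δ p a with
    | none =>
      cases h2 : δ q a with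
      | none => simp [stepWord, h1, h2] at hu
      | some q' => exact here hq hp (by simp [h2]) h1
    | some p' =>
      cases h2 : δ q a with
      | none => exact here hp hq (by simp [h1]) h2
      | some q' =>
        obtain ⟨v, hv, hc⟩ := ih (by simpa [stepWord, h1, h2] using hu)
          (mem_fimg_singleton.2 ⟨p, hp, h1⟩) (mem_fimg_singleton.2 ⟨q, hq, h2⟩)
        exact ⟨a :: v, by simpa using hv, by rwa [fimg_cons]⟩

theorem exists_fimg_card_eq_one_of_not_branching [Nontrivial Q] (hb : ∀ q, ¬ Branching δ q)
    (hs : StronglyConnected δ) {z : List L} {d e : Q} (hd : stepWord δ d z = some e)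
    (hz : ∀ q r, stepWord δ q z = some r → r = e) (k : ℕ) {P : Finset Q} (hP : P.Nonempty)
    (hcard : P.card ≤ 2 ^ k) :
    ∃ u : List L, u.length ≤ k * (Fintype.card Q + 1) ∧ (fimg δ P u).card = 1 := by
  have hout : ∀ q, ∃ a, (δ q a).isSome := by
    intro q
    obtain ⟨p, hpq⟩ := exists_ne q
    obtain ⟨w, hw⟩ := hs q p
    cases w with
    | nil => exact absurd (Option.some.inj hw).symm hpq
    | cons a w =>
      refine ⟨a, ?_⟩
      cases h : δ q a <;> simp [stepWord, h] at hw ⊢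
  induction k generalizing P with
  | zero =>
    have := hP.card_pos
    exact ⟨[], by simp, by rw [fimg_nil]; omega⟩
  | succ k ih =>
    by_cases h1 : P.card = 1
    · exact ⟨[], by simp, by rwa [fimg_nil]⟩
    have h2 : 1 < P.card := by
      have := hP.card_pos
      omega
    obtain ⟨p, hp, q, hq, hpq⟩ := Finset.one_lt_card.1 h2
    obtain ⟨u, hu, hsep⟩ := exists_short_separating
      (fun hI => hpq (eq_of_insep_of_not_branching hb hs hd hz hI))
    obtain ⟨v, hv, hc⟩ := exists_hasChoice_of_separating hout hsep hp hq
    obtain ⟨a, hne, hle⟩ := hc.exists_fimg_card_le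
    rw [Finset.filter_true_of_mem (fun q _ => hb q), ← fimg_append] at hle
    rw [← fimg_append] at hne
    have := card_fimg_le δ P v
    obtain ⟨t, ht, ht'⟩ := ih hne (by rw [pow_succ] at hcard; omega)
    refine ⟨v ++ [a] ++ t, ?_, by rwa [fimg_append]⟩
    simp only [List.length_append, List.length_singleton]
    rw [Nat.succ_mul]
    omega

end NoBranching

section Merging

variable {R Λ : Type*} [Fintype R]

theorem exists_short_foldl_eq (f : R → Λ → R) {p q : R}
    (h : ∃ t : List Λ, t.foldl f p = t.foldl f q) :
    ∃ t : List Λ, t.length ≤ Fintype.card R ^ 2 ∧ t.foldl f p = t.foldl f q := by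
  by_contra! hc
  obtain ⟨t, ht⟩ := h
  set δ : R × R → Λ → Option (R × R) := fun x l => some (f x.1 l, f x.2 l)
  have hstep : ∀ (t : List Λ) (x : R × R),
      stepWord δ x t = some (t.foldl f x.1, t.foldl f x.2) := by
    intro t
    induction t with
    | nil => simp [stepWord]
    | cons l t ih => exact fun x => ih _
  have key := apply_opWord_eq_zero (letterOp δ) (fun x => if x.1 = x.2 then 1 else 0)
    (LinearMap.proj (R := ℚ) (φ := fun _ => ℚ) (p, q)) (by
      intro u hu
      rw [Module.finrank_fintype_fun_eq_card, Fintype.card_prod, ← sq] at hu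
      rw [LinearMap.proj_apply, opWord_letterOp, hstep]
      simpa using hc u hu) t
  rw [LinearMap.proj_apply, opWord_letterOp, hstep] at key
  simp [ht] at key

/-- If the image of every word that is not a singleton contains two different states that can be
merged, then there is a short word with a singleton image. -/
theorem exists_short_foldl_const (f : R → Λ → R)
    (h : ∀ (s : List Λ) (p q : R), s.foldl f p ≠ s.foldl f q →
      ∃ p' q', s.foldl f p' ≠ s.foldl f q' ∧
        ∃ t : List Λ, t.foldl f (s.foldl f p') = t.foldl f (s.foldl f q')) :
    ∃ t : List Λ, t.length ≤ Fintype.card R ^ 3 ∧ ∀ p q, t.foldl f p = t.foldl f q := by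
  have key : ∀ (k : ℕ) (s : List Λ), (Finset.univ.image (s.foldl f)).card ≤ k + 1 →
      ∃ t : List Λ, t.length ≤ k * Fintype.card R ^ 2 ∧
        ∀ p q, (s ++ t).foldl f p = (s ++ t).foldl f q := by
    intro k
    induction k with
    | zero =>
      intro s hs
      refine ⟨[], by simp, fun p q => ?_⟩
      rw [List.append_nil]
      exact Finset.card_le_one.1 hs _ (Finset.mem_image_of_mem _ (Finset.mem_univ p)) _
        (Finset.mem_image_of_mem _ (Finset.mem_univ q))
    | succ k ih =>
      intro s hs
      by_cases hc : ∀ p q, s.foldl f p = s.foldl f q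
      · exact ⟨[], by simp, by simpa using hc⟩
      push Not at hc
      obtain ⟨p, q, hpq⟩ := hc
      obtain ⟨p', q', hne, ht⟩ := h s p q hpq
      obtain ⟨t, htl, ht⟩ := exists_short_foldl_eq f ht
      have hlt : (Finset.univ.image ((s ++ t).foldl f)).card <
          (Finset.univ.image (s.foldl f)).card := by
        have him : Finset.univ.image ((s ++ t).foldl f) =
            (Finset.univ.image (s.foldl f)).image (t.foldl f) := by
          rw [Finset.image_image]
          congr 1
          ext p
          simp
        rw [him]
        refine lt_of_le_of_ne Finset.card_image_le fun hcard => hne ?_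
        exact Finset.card_image_iff.1 hcard
          (Finset.mem_coe.2 (Finset.mem_image_of_mem _ (Finset.mem_univ p')))
          (Finset.mem_coe.2 (Finset.mem_image_of_mem _ (Finset.mem_univ q'))) ht
      obtain ⟨v, hv, hvc⟩ := ih (s ++ t) (by omega)
      refine ⟨t ++ v, ?_, by simpa using hvc⟩
      rw [List.length_append, Nat.succ_mul]
      omega
  obtain ⟨t, ht, hc⟩ := key (Fintype.card R) [] (Finset.card_image_le.trans (by simp))
  exact ⟨t, by rwa [pow_succ'], hc⟩

end Merging

section Induced

variable {Q L : Type*} [Fintype Q] {δ : Q → L → Option Q} {C : Q → Prop} {R : Finset Q}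
  {w : List L}

/-- The words of length at most the number of states taking some state of `R` into `C`. -/
abbrev ReturnWord (δ : Q → L → Option Q) (C : Q → Prop) (R : Finset Q) : Type _ :=
  {u : List L // u.length ≤ Fintype.card Q ∧ ∃ p : R, ∃ c, C c ∧ stepWord δ p u = some c}

theorem exists_foldl_eq_of_isReset (hs : StronglyConnected δ) {z : List L} {d e : Q}
    (hd : stepWord δ d z = some e) (hz : ∀ q r, stepWord δ q z = some r → r = e)
    (hRC : ∀ r ∈ R, ∃ c, C c ∧ stepWord δ c w = some r) {f : R → ReturnWord δ C R → R}
    (hf : ∀ p l, ∃ c, C c ∧ stepWord δ p.1 l.1 = some c ∧ stepWord δ c w = some (f p l).1)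
    (s : List (ReturnWord δ C R)) (p₀ q₀ : R) (hpq : s.foldl f p₀ ≠ s.foldl f q₀) :
    ∃ p q, s.foldl f p ≠ s.foldl f q ∧
      ∃ t : List (ReturnWord δ C R), t.foldl f (s.foldl f p) = t.foldl f (s.foldl f q) := by
  by_contra! hinj
  set P : Finset R := Finset.univ.image (s.foldl f)
  have hP : ∀ p, s.foldl f p ∈ P := fun p => Finset.mem_image_of_mem _ (Finset.mem_univ p)
  set g : R → ℚ := fun r =>
    (if r = s.foldl f p₀ then 1 else 0) - (if r = s.foldl f q₀ then 1 else 0) with hg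
  set x : R → ℚ := fun r => g (s.foldl f r) with hx
  have hsum : ∀ l, ∑ p ∈ P, x (f p l) = 0 := by
    intro l
    have hmaps : Set.MapsTo (fun p => s.foldl f (f p l)) (P : Set R) P := fun p _ => hP _
    have hinjOn : Set.InjOn (fun p => s.foldl f (f p l)) (P : Set R) := by
      intro p hp q hq hpq'
      obtain ⟨p', -, rfl⟩ := Finset.mem_image.1 (Finset.mem_coe.1 hp)
      obtain ⟨q', -, rfl⟩ := Finset.mem_image.1 (Finset.mem_coe.1 hq)
      by_contra hne
      exact hinj p' q' hne (l :: s) hpq'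
    rw [Finset.sum_nbij (t := P) (g := g) (fun p => s.foldl f (f p l)) hmaps hinjOn
      (Finset.surjOn_of_injOn_of_card_le _ hmaps hinjOn le_rfl) (fun p _ => rfl)]
    simp [hg, Finset.sum_sub_distrib, hP]
  set y : Q → ℚ := fun q =>
    if C q then (stepWord δ q w).elim 0 (fun r => if h : r ∈ R then x ⟨r, h⟩ else 0) else 0
    with hy
  have hyx : ∀ c (r : R), C c → stepWord δ c w = some r.1 → y c = x r := by
    intro c r hc hr
    simp [hy, hc, hr]
  have key : ∀ u : List L, ∑ p ∈ P, (stepWord δ p.1 u).elim 0 y = 0 := by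
    intro u
    set φ : (Q → ℚ) →ₗ[ℚ] ℚ :=
      ∑ p ∈ P, LinearMap.proj (R := ℚ) (φ := fun _ => ℚ) p.1 with hφ
    have ev : ∀ u, φ (opWord (letterOp δ) u y) = ∑ p ∈ P, (stepWord δ p.1 u).elim 0 y := by
      intro u
      rw [hφ, LinearMap.sum_apply]
      exact Finset.sum_congr rfl fun p _ => opWord_letterOp δ u y p.1
    rw [← ev]
    refine apply_opWord_eq_zero (letterOp δ) y φ (fun u hu => ?_) u
    rw [Module.finrank_fintype_fun_eq_card] at hu
    rw [ev]
    by_cases hl : ∃ p : R, ∃ c, C c ∧ stepWord δ p u = some c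
    · rw [← hsum ⟨u, hu, hl⟩]
      refine Finset.sum_congr rfl fun p _ => ?_
      obtain ⟨c, hc, h1, h2⟩ := hf p ⟨u, hu, hl⟩
      rw [h1]
      exact hyx c _ hc h2
    · refine Finset.sum_eq_zero fun p _ => ?_
      cases h : stepWord δ p.1 u with
      | none => rfl
      | some c =>
        have : ¬ C c := fun hc => hl ⟨p, c, hc, h⟩
        simp [hy, this]
  obtain ⟨c, hc, hcw⟩ := hRC p₀.1 p₀.2
  obtain ⟨u, hu⟩ := hs (s.foldl f p₀).1 d
  obtain ⟨v, hv⟩ := hs e c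
  have hyc : y c = 1 := by
    rw [hyx c p₀ hc hcw]
    simp [hx, hg, hpq]
  have hval : ∀ q r, stepWord δ q (u ++ (z ++ v)) = some r → r = c := by
    intro q r hr
    obtain ⟨a, -, hr⟩ := stepWord_append_eq_some.1 hr
    obtain ⟨b, hb, hr⟩ := stepWord_append_eq_some.1 hr
    obtain rfl := hz _ _ hb
    exact Option.some.inj (hr.symm.trans hv)
  have hpos : 0 < ∑ p ∈ P, (stepWord δ p.1 (u ++ (z ++ v))).elim 0 y := by
    refine Finset.sum_pos' (fun p _ => ?_) ⟨_, hP p₀, ?_⟩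
    · cases h : stepWord δ p.1 (u ++ (z ++ v)) with
      | none => rfl
      | some r =>
        rw [hval _ _ h]
        exact zero_le_one.trans hyc.ge
    · rw [stepWord_append_eq_some.2 ⟨d, hu, stepWord_append_eq_some.2 ⟨e, hd, hv⟩⟩]
      exact zero_lt_one.trans_le hyc.ge
  exact hpos.ne' (key _)

theorem exists_short_reset_of_returns (hs : StronglyConnected δ) {z : List L} {d e : Q}
    (hd : stepWord δ d z = some e) (hz : ∀ q r, stepWord δ q z = some r → r = e)
    (hR : R.Nonempty) (hRC : ∀ r ∈ R, ∃ c, C c ∧ stepWord δ c w = some r)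
    (hCR : ∀ c, C c → ∃ r ∈ R, stepWord δ c w = some r)
    (hret : ∀ p ∈ R, ∀ q ∈ R, ∀ u c, C c → stepWord δ p u = some c →
      ∃ c', C c' ∧ stepWord δ q u = some c') :
    ∃ t : List L, t.length ≤ R.card ^ 3 * (Fintype.card Q + w.length) ∧
      ∃ r, ∀ p ∈ R, stepWord δ p t = some r := by
  have hex : ∀ (p : R) (l : ReturnWord δ C R), ∃ r : R, ∃ c, C c ∧ stepWord δ p.1 l.1 = some c ∧
      stepWord δ c w = some r.1 := by
    rintro p ⟨u, hu, q, c, hc, h⟩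
    obtain ⟨c', hc', h'⟩ := hret q q.2 p p.2 u c hc h
    obtain ⟨r, hr, h2⟩ := hCR c' hc'
    exact ⟨⟨r, hr⟩, c', hc', h', h2⟩
  choose f hf using hex
  obtain ⟨t, ht, hconst⟩ := exists_short_foldl_const f
    (exists_foldl_eq_of_isReset hs hd hz hRC hf)
  rw [Fintype.card_coe] at ht
  have hflat : ∀ (t : List (ReturnWord δ C R)),
      (t.flatMap (fun l => l.1 ++ w)).length ≤ t.length * (Fintype.card Q + w.length) ∧
      ∀ p : R, stepWord δ p.1 (t.flatMap (fun l => l.1 ++ w)) = some (t.foldl f p).1 := by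
    intro t
    induction t with
    | nil => simp [stepWord]
    | cons l t ih =>
      refine ⟨?_, fun p => ?_⟩
      · have := l.2.1
        rw [List.flatMap_cons, List.length_append, List.length_append, List.length_cons,
          Nat.succ_mul]
        omega
      · obtain ⟨c, -, h1, h2⟩ := hf p l
        rw [List.flatMap_cons]
        exact stepWord_append_eq_some.2
          ⟨_, stepWord_append_eq_some.2 ⟨_, h1, h2⟩, ih.2 _⟩
  obtain ⟨p₀, hp₀⟩ := hR
  refine ⟨t.flatMap (fun l => l.1 ++ w), (hflat t).1.trans (Nat.mul_le_mul_right _ ht),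
    (t.foldl f ⟨p₀, hp₀⟩).1, fun p hp => ?_⟩
  rw [(hflat t).2 ⟨p, hp⟩, hconst ⟨p, hp⟩ ⟨p₀, hp₀⟩]

end Induced

section RootedTreeReset

variable {Q L : Type*} [Fintype Q] {δ : Q → L → Option Q} {root : Q} {depth size : Q → ℕ}

theorem IsRootedTree.stronglyConnected (h : IsRootedTree δ root depth size) :
    StronglyConnected δ := fun p q => by
  obtain ⟨u, -, hu⟩ := h.exists_stepWord p q
  exact ⟨u, hu⟩

/-- The states inseparable from the root are synchronized by a short word. -/
theorem IsRootedTree.exists_insep_root_synchronizing (h : IsRootedTree δ root depth size) {b : Q}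
    (hb : Branching δ b) {M : ℕ} (hM : Fintype.card Q ^ 2 < 2 ^ M) {z : List L} {d e : Q}
    (hd : stepWord δ d z = some e) (hz : ∀ q r, stepWord δ q z = some r → r = e) :
    ∃ t : List L,
      t.length ≤ 3 * Fintype.card Q + (M + 1) ^ 3 * (4 * Fintype.card Q) ∧
      ∃ r, ∀ p, Insep δ root p → stepWord δ p t = some r := by
  obtain ⟨w, hw, hne, hcard⟩ := h.exists_fimg_insep_root_card_le hb hM
  set R := fimg δ (Finset.univ.filter (fun q => Insep δ root q)) w with hR
  have memR : ∀ r, r ∈ R ↔ ∃ c, Insep δ root c ∧ stepWord δ c w = some r := fun r => by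
    simp [hR, mem_fimg]
  have hCR : ∀ c, Insep δ root c → ∃ r ∈ R, stepWord δ c w = some r := by
    intro c hc
    obtain ⟨r, hr⟩ := hne
    obtain ⟨c', hc', hr⟩ := (memR r).1 hr
    obtain ⟨r', hr', -⟩ := (hc'.symm.trans hc).exists_stepWord hr
    exact ⟨r', (memR r').2 ⟨c, hc, hr'⟩, hr'⟩
  obtain ⟨t, ht, r, hr⟩ := exists_short_reset_of_returns (C := Insep δ root) h.stronglyConnected
    hd hz hne (fun r hr => (memR r).1 hr) hCR (by
      intro p hp q hq u c hc hu
      obtain ⟨c₁, hc₁, hp⟩ := (memR p).1 hp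
      obtain ⟨c₂, hc₂, hq⟩ := (memR q).1 hq
      obtain ⟨c', hc', hI⟩ := ((hc₁.symm.trans hc₂).of_stepWord hp hq).exists_stepWord hu
      exact ⟨c', hc.trans hI, hc'⟩)
  refine ⟨w ++ t, ?_, r, fun p hp => ?_⟩
  · rw [List.length_append]
    have := ht.trans (Nat.mul_le_mul (Nat.pow_le_pow_left hcard 3)
      (show Fintype.card Q + w.length ≤ 4 * Fintype.card Q by omega))
    omega
  · obtain ⟨r', hr', e'⟩ := hCR p hp
    exact stepWord_append_eq_some.2 ⟨r', e', hr r' hr'⟩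

theorem IsRootedTree.exists_fimg_univ_card_eq_one [Nontrivial Q]
    (h : IsRootedTree δ root depth size) {M : ℕ} (hM : Fintype.card Q ^ 2 < 2 ^ M)
    (hsync : ∃ z : List L, (fimg δ Finset.univ z).card = 1) :
    ∃ u : List L, u.length ≤ 17 * Fintype.card Q * (M + 1) ^ 3 ∧
      (fimg δ Finset.univ u).card = 1 := by
  obtain ⟨z, hz⟩ := hsync
  obtain ⟨e, he⟩ := Finset.card_eq_one.1 hz
  obtain ⟨d, -, hd⟩ := mem_fimg.1 (he ▸ Finset.mem_singleton_self e)
  replace hz : ∀ q r, stepWord δ q z = some r → r = e := fun q r hr =>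
    Finset.mem_singleton.1 (he ▸ mem_fimg.2 ⟨q, Finset.mem_univ q, hr⟩)
  have hn : 0 < Fintype.card Q := Fintype.card_pos
  have hcard : Fintype.card Q ≤ 2 ^ M := (Nat.le_self_pow two_ne_zero _).trans hM.le
  by_cases hb : ∀ q, ¬ Branching δ q
  · obtain ⟨u, hu, h1⟩ := exists_fimg_card_eq_one_of_not_branching hb h.stronglyConnected hd hz M
      Finset.univ_nonempty (by rwa [Finset.card_univ])
    refine ⟨u, hu.trans ?_, h1⟩
    calc M * (Fintype.card Q + 1) ≤ (M + 1) ^ 3 * (17 * Fintype.card Q) :=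
          Nat.mul_le_mul (M.le_succ.trans (Nat.le_self_pow three_ne_zero _)) (by omega)
      _ = 17 * Fintype.card Q * (M + 1) ^ 3 := mul_comm _ _
  push Not at hb
  obtain ⟨b, hb⟩ := hb
  obtain ⟨u₁, hu₁, hne₁, hc₁⟩ := h.exists_fimg_card_le_of_le_two_pow hb hM M
    (Finset.univ_nonempty (α := Q)) (by
      rw [Finset.card_univ]
      exact hcard.trans (Nat.le_mul_of_pos_left _ M.succ_pos))
  obtain ⟨u₂, hu₂, hne₂, hI⟩ := exists_insep_fimg δ _ hne₁
  rw [← fimg_append] at hne₂ hI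
  obtain ⟨p, hp⟩ := hne₂
  obtain ⟨u₃, hu₃, hroot⟩ := h.to_root p
  obtain ⟨t, ht, r, hr⟩ := h.exists_insep_root_synchronizing hb hM hd hz
  refine ⟨u₁ ++ u₂ ++ (u₃ ++ t), ?_, Finset.card_eq_one.2 ⟨r, ?_⟩⟩
  · have h2 : u₂.length ≤ (M + 1) * Fintype.card Q := hu₂.trans (Nat.mul_le_mul_right _ hc₁)
    simp only [List.length_append]
    generalize Fintype.card Q = n at *
    have e1 : M * (2 * (M + 1) * (3 * n + 1)) ≤ 8 * (n * (M + 1) ^ 3) := by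
      calc M * (2 * (M + 1) * (3 * n + 1))
          ≤ (M + 1) ^ 2 * (2 * (M + 1) * (4 * n)) := by
            gcongr
            · nlinarith
            · omega
        _ = 8 * (n * (M + 1) ^ 3) := by ring
    have e2 : (M + 1) * n ≤ n * (M + 1) ^ 3 := by
      rw [mul_comm]
      exact Nat.mul_le_mul_left _ (Nat.le_self_pow three_ne_zero _)
    have e3 : n ≤ n * (M + 1) ^ 3 := Nat.le_mul_of_pos_right _ (by positivity)
    have e4 : (M + 1) ^ 3 * (4 * n) = 4 * (n * (M + 1) ^ 3) := by ring
    rw [mul_assoc 17]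
    omega
  · have key : ∀ q ∈ fimg δ Finset.univ (u₁ ++ u₂), stepWord δ q (u₃ ++ t) = some r := by
      intro q hq
      obtain ⟨q', hq', hI'⟩ := (hI p hp q hq).exists_stepWord hroot
      exact stepWord_append_eq_some.2 ⟨q', hq', hr q' hI'⟩
    rw [fimg_append]
    ext s
    rw [mem_fimg, Finset.mem_singleton]
    constructor
    · rintro ⟨q, hq, hs⟩
      exact Option.some.inj (hs.symm.trans (key q hq))
    · rintro rfl
      exact ⟨p, hp, key p hp⟩

end RootedTreeReset

section Literal

variable {A : Type*} {X : Set (List A)}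

theorem properPrefixes_of_prefix {p q : List A} (hq : q ∈ ProperPrefixes X) (h : p <+: q) :
    p ∈ ProperPrefixes X := by
  obtain ⟨x, hx, hqx, hne⟩ := hq
  exact ⟨x, hx, h.trans hqx, fun e =>
    hne (hqx.eq_of_length_le (e ▸ h.length_le))⟩

theorem IsPrefixCode.notMem_properPrefixes (hX : IsPrefixCode X) {x : List A} (hx : x ∈ X) :
    x ∉ ProperPrefixes X := by
  rintro ⟨y, hy, hxy, hne⟩
  exact hne (hX x hx y hy hxy)

theorem litDelta_of_mem {p : ProperPrefixes X} {a : A} (h : p.val ++ [a] ∈ ProperPrefixes X) :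
    litDelta X p a = some ⟨p.val ++ [a], h⟩ :=
  dif_pos h

theorem stepWord_litDelta_of_mem (p : ProperPrefixes X) (v : List A)
    (h : p.val ++ v ∈ ProperPrefixes X) :
    stepWord (litDelta X) p v = some ⟨p.val ++ v, h⟩ := by
  induction v generalizing p with
  | nil => simp [stepWord]
  | cons a v ih =>
    have hpa : p.val ++ [a] ∈ ProperPrefixes X := properPrefixes_of_prefix h ⟨v, by simp⟩
    have := ih ⟨p.val ++ [a], hpa⟩ (by simpa using h)
    simpa [stepWord, litDelta_of_mem hpa] using this

theorem litDelta_eq_some {p q : ProperPrefixes X} {a : A} (h : litDelta X p a = some q) :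
    q.val = p.val ++ [a] ∨ q.val = [] := by
  unfold litDelta at h
  split_ifs at h
  · exact Or.inl (by rw [← Option.some.inj h])
  · exact Or.inr (by rw [← Option.some.inj h])

theorem stepWord_litDelta_of_mem_code (hX : IsPrefixCode X) {root : ProperPrefixes X}
    (hroot : root.val = []) (p : ProperPrefixes X) {v : List A} (h : p.val ++ v ∈ X) :
    stepWord (litDelta X) p v = some root := by
  rcases List.eq_nil_or_concat' v with rfl | ⟨v, a, rfl⟩
  · exact absurd p.2 (hX.notMem_properPrefixes (by simpa using h))
  · have hv : p.val ++ v ∈ ProperPrefixes X := ⟨_, h, ⟨[a], by simp⟩, by simp⟩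
    refine stepWord_append_eq_some.2 ⟨_, stepWord_litDelta_of_mem p v hv, ?_⟩
    have h' : p.val ++ v ++ [a] ∈ X := by simpa using h
    rw [stepWord_singleton, litDelta, dif_neg (hX.notMem_properPrefixes h'), dif_pos h']
    exact congrArg some (Subtype.ext hroot.symm)

theorem finite_properPrefixes (hX : X.Finite) : (ProperPrefixes X).Finite := by
  refine (hX.biUnion fun x _ => (List.finite_toSet x.inits)).subset ?_
  rintro q ⟨x, hx, hq, -⟩
  exact Set.mem_biUnion hx ((List.mem_inits _ _).2 hq)

variable [Fintype (ProperPrefixes X)]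

theorem length_lt_card_properPrefixes (q : ProperPrefixes X) :
    q.val.length < Fintype.card (ProperPrefixes X) := by
  rw [← Nat.succ_le_iff, Nat.succ_eq_add_one, ← Fintype.card_fin (q.val.length + 1)]
  refine Fintype.card_le_of_injective (fun i : Fin (q.val.length + 1) =>
    (⟨q.val.take i, properPrefixes_of_prefix q.2 (List.take_prefix _ _)⟩ : ProperPrefixes X)) ?_
  intro i j hij
  have := congrArg List.length (Subtype.ext_iff.1 hij)
  simp only [List.length_take] at this
  omega

theorem childWeight_litDelta_le {root : ProperPrefixes X} (hroot : root.val = [])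
    (q : ProperPrefixes X) (a : A) :
    childWeight (litDelta X) root
      (fun p => (Finset.univ.filter (fun z : ProperPrefixes X => p.val <+: z.val)).card) q a ≤
      (Finset.univ.filter (fun z : ProperPrefixes X => q.val ++ [a] <+: z.val)).card := by
  unfold childWeight
  cases h : litDelta X q a with
  | none => simp
  | some p =>
    rcases litDelta_eq_some h with hp | hp
    · simp only [Option.elim_some, hp]
      split_ifs <;> simp
    · have : p = root := Subtype.ext (hp.trans hroot.symm)
      simp [this]

theorem isRootedTree_litDelta (hX : IsPrefixCode X) {root : ProperPrefixes X}
    (hroot : root.val = []) :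
    IsRootedTree (litDelta X) root (fun p => p.val.length)
      (fun p => (Finset.univ.filter (fun z : ProperPrefixes X => p.val <+: z.val)).card) where
  depth_lt := length_lt_card_properPrefixes
  depth_step q a p h hp := by
    rcases litDelta_eq_some h with h | h
    · simp [h]
    · exact absurd (Subtype.ext (h.trans hroot.symm)) hp
  size_pos q := Finset.card_pos.2 ⟨q, by simp⟩
  size_le q := Finset.card_le_univ _
  childWeight_le q a := by
    refine (childWeight_litDelta_le hroot q a).trans (Finset.card_le_card fun z => ?_)
    simp only [Finset.mem_filter, Finset.mem_univ, true_and]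
    exact (List.prefix_append _ _).trans
  childWeight_add_le q a b hab := by
    refine (Nat.add_le_add (childWeight_litDelta_le hroot q a)
      (childWeight_litDelta_le hroot q b)).trans ?_
    rw [← Finset.card_union_of_disjoint]
    · refine Finset.card_le_card fun z => ?_
      simp only [Finset.mem_union, Finset.mem_filter, Finset.mem_univ, true_and]
      rintro (h | h) <;> exact (List.prefix_append _ _).trans h
    · refine Finset.disjoint_filter.2 fun z _ ha hb => hab ?_
      have := (List.prefix_of_prefix_length_le ha hb (by simp)).eq_of_length (by simp)
      simpa using this
  to_root q := by
    obtain ⟨x, hx, ⟨v, hv⟩, hne⟩ := q.2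
    refine ⟨v, ?_, stepWord_litDelta_of_mem_code hX hroot q (hv ▸ hx)⟩
    have hx0 : x ≠ [] := by
      rintro rfl
      exact hne (List.append_eq_nil_iff.1 hv).1
    have hlt := length_lt_card_properPrefixes (X := X)
      ⟨x.dropLast, x, hx, x.dropLast_prefix, fun e => by
        have := congrArg List.length e
        have := List.length_pos_iff.2 hx0
        simp only [List.length_dropLast] at *
        omega⟩
    have := congrArg List.length hv
    simp only [List.length_append, List.length_dropLast] at *
    omega
  from_root q := by
    refine ⟨q.val, (length_lt_card_properPrefixes q).le, ?_⟩
    rw [stepWord_litDelta_of_mem root q.val (by simp [hroot])]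
    exact congrArg some (Subtype.ext (by simp [hroot]))

end Literal

theorem coe_fimg_univ {Q L : Type*} [Fintype Q] (δ : Q → L → Option Q) (w : List L) :
    (fimg δ Finset.univ w : Set Q) = img δ Set.univ w := by
  ext p
  simp [mem_fimg, img]

theorem two_mul_log_add_three_le {n : ℕ} (hn : 2 ≤ n) :
    ((2 * (Nat.log 2 n + 1) + 1 : ℕ) : ℝ) ≤ 5 * Real.logb 2 n := by
  have h1 : 1 ≤ Nat.log 2 n := Nat.log_pos one_lt_two hn
  have h2 : ((Nat.log 2 n : ℕ) : ℝ) ≤ Real.logb 2 n := by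
    exact_mod_cast Real.natLog_le_logb n 2
  have h3 : (1 : ℝ) ≤ Nat.log 2 n := by exact_mod_cast h1
  push_cast
  linarith

/-- there is a constant `C > 0` such that every synchronizing literal
automaton of a finite prefix code with `n ≥ 2` states has reset threshold at most
`C·n·(log₂ n)³`. -/
theorem stmt16 :
    ∃ C : ℝ, 0 < C ∧
      ∀ (A : Type) [Fintype A] (X : Finset (List A)),
        IsPrefixCode (↑X : Set (List A)) →
        ∀ n : ℕ, n = (ProperPrefixes (↑X : Set (List A))).ncard → 2 ≤ n →
        (∃ w : List A, (img (litDelta (↑X : Set (List A))) Set.univ w).ncard = 1) →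
        ((sInf {k : ℕ | ∃ w : List A, w.length = k ∧
            (img (litDelta (↑X : Set (List A))) Set.univ w).ncard = 1} : ℕ) : ℝ) ≤
          C * (n : ℝ) * (Real.logb 2 (n : ℝ)) ^ 3 := by
  refine ⟨2125, by norm_num, fun A _ X hX n hn h2 hsync => ?_⟩
  have : Fintype (ProperPrefixes (↑X : Set (List A))) :=
    (finite_properPrefixes X.finite_toSet).fintype
  have hcard : Fintype.card (ProperPrefixes (↑X : Set (List A))) = n := by
    rw [hn, Set.ncard_eq_toFinset_card', Set.toFinset_card]
  have : Nontrivial (ProperPrefixes (↑X : Set (List A))) :=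
    Fintype.one_lt_card_iff_nontrivial.1 (by omega)
  obtain ⟨q⟩ := (inferInstance : Nonempty (ProperPrefixes (↑X : Set (List A))))
  have hM : Fintype.card (ProperPrefixes (↑X : Set (List A))) ^ 2 <
      2 ^ (2 * (Nat.log 2 n + 1)) := by
    rw [hcard, mul_comm 2, pow_mul]
    exact Nat.pow_lt_pow_left (Nat.lt_pow_succ_log_self one_lt_two n) two_ne_zero
  have hiff : ∀ w, (img (litDelta (↑X : Set (List A))) Set.univ w).ncard = 1 ↔
      (fimg (litDelta (↑X : Set (List A))) Finset.univ w).card = 1 := fun w => by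
    rw [← coe_fimg_univ, Set.ncard_coe_finset]
  simp only [hiff] at hsync ⊢
  obtain ⟨u, hu, hu1⟩ := (isRootedTree_litDelta hX
    (root := ⟨[], properPrefixes_of_prefix q.2 List.nil_prefix⟩) rfl).exists_fimg_univ_card_eq_one
    hM hsync
  rw [hcard] at hu
  refine (Nat.cast_le.2 (le_trans (Nat.sInf_le ?_) hu)).trans ?_
  · exact ⟨u, rfl, hu1⟩
  calc ((17 * n * (2 * (Nat.log 2 n + 1) + 1) ^ 3 : ℕ) : ℝ)
      = 17 * n * ((2 * (Nat.log 2 n + 1) + 1 : ℕ) : ℝ) ^ 3 := by push_cast; ring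
    _ ≤ 17 * n * (5 * Real.logb 2 n) ^ 3 := by
        gcongr
        exact two_mul_log_add_three_le h2
    _ = 2125 * n * Real.logb 2 n ^ 3 := by ring
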